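/- arXiv:1601.04998 — 2 statements merged into one kernel-verified Lean document; each statement's English description precedes it below -/
import Mathlib

section
/- Let R be a local ring, let κ, λ ∈ R³ represent lines k, l and let a, b ∈ R³ represent points A, B of the projective plane over R. If δ(k,l,A,B) holds, then (κ·a)(λ·b) − (κ·b)(λ·a) = 0, where κ·a denotes κ₀a₀+κ₁a₁+κ₂a₂, etc. -/
/-- A vector in `R³` has at least one coordinate a unit, hence represents a point
(or line) of the projective plane over `R`. -/
def IsRep {R : Type*} [CommRing R] (a : Fin 3 → R) : Prop :=
  IsUnit (a 0) ∨ IsUnit (a 1) ∨ IsUnit (a 2)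

/-- The bilinear pairing between a line and a point. -/
def dot {R : Type*} [CommRing R] (l a : Fin 3 → R) : R :=
  l 0 * a 0 + l 1 * a 1 + l 2 * a 2

/-- The points (or lines) represented by `a` and `b` are apart from each other. -/
def Apart {R : Type*} [CommRing R] (a b : Fin 3 → R) : Prop :=
  IsUnit (a 0 * b 1 - a 1 * b 0) ∨ IsUnit (a 1 * b 2 - a 2 * b 1) ∨
    IsUnit (a 2 * b 0 - a 0 * b 2)

/-- `Delta k l a b` : there exist a line `r` and a point `X` such that the points
`A`, `B`, `X` all lie on `r` and `X` lies on each of `k`, `l` and `r`. -/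
def Delta {R : Type*} [CommRing R] (k l a b : Fin 3 → R) : Prop :=
  ∃ r X : Fin 3 → R, IsRep r ∧ IsRep X ∧
    dot r a = 0 ∧ dot r b = 0 ∧ dot r X = 0 ∧ dot k X = 0 ∧ dot l X = 0

theorem IsRep.exists_isUnit {R : Type*} [CommRing R] {r : Fin 3 → R} (hr : IsRep r) :
    ∃ i, IsUnit (r i) := by
  rcases hr with h | h | h
  exacts [⟨0, h⟩, ⟨1, h⟩, ⟨2, h⟩]

theorem dot_eq_dotProduct {R : Type*} [CommRing R] (a b : Fin 3 → R) : dot a b = a ⬝ᵥ b := by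
  simp [dot, dotProduct, Fin.sum_univ_three]

open Matrix in
/-- The `2 × 2` minors of `r` and the cross product of two vectors orthogonal to `r` vanish. -/
theorem mul_cross_comm_of_dot_eq_zero {R : Type*} [CommRing R] {r a b : Fin 3 → R}
    (ha : dot r a = 0) (hb : dot r b = 0) (i j : Fin 3) :
    r i * (a ⨯₃ b) j = r j * (a ⨯₃ b) i := by
  simp only [dot] at ha hb
  fin_cases i <;> fin_cases j <;> simp [cross_apply] <;> grind

open Matrix in
/-- If `a` and `b` lie on the line represented by `r`, then `a ⨯₃ b` is a multiple of `r`. -/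
theorem IsRep.exists_cross_eq_smul {R : Type*} [CommRing R] {r a b : Fin 3 → R}
    (hr : IsRep r) (ha : dot r a = 0) (hb : dot r b = 0) : ∃ s : R, a ⨯₃ b = s • r := by
  obtain ⟨i, hi⟩ := hr.exists_isUnit
  obtain ⟨u, hu⟩ := hi.exists_left_inv
  refine ⟨u * (a ⨯₃ b) i, funext fun j => ?_⟩
  have h := mul_cross_comm_of_dot_eq_zero ha hb i j
  simp only [Pi.smul_apply, smul_eq_mul]
  linear_combination u * h - (a ⨯₃ b) j * hu

/-- If `δ(k,l,A,B)` holds on the projective plane over a local ring, then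
`(κ·a)(λ·b) − (κ·b)(λ·a) = 0`. -/
theorem delta_det_eq_zero {R : Type*} [CommRing R] [IsLocalRing R]
    (k l a b : Fin 3 → R)
    (hk : IsRep k) (hl : IsRep l) (ha : IsRep a) (hb : IsRep b)
    (h : Delta k l a b) :
    dot k a * dot l b - dot k b * dot l a = 0 := by
  obtain ⟨r, X, hr, hX, hra, hrb, hrX, hkX, hlX⟩ := h
  obtain ⟨s, hs⟩ := hr.exists_cross_eq_smul hra hrb
  rw [dot_eq_dotProduct, dotProduct_comm, ← dot_eq_dotProduct] at hkX hlX
  obtain ⟨t, ht⟩ := hX.exists_cross_eq_smul hkX hlX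
  rw [dot_eq_dotProduct] at hrX
  simp only [dot_eq_dotProduct]
  rw [← cross_dot_cross, hs, ht, smul_dotProduct, dotProduct_smul, dotProduct_comm, hrX,
    smul_zero, smul_zero]
end

section
/- Let R be a commutative ring, let a, b, x, y, z, w ∈ R³ represent points A, B, X, Y, Z, W and let κ, λ ∈ R³ represent lines k, l of the projective plane over R. Suppose X and Y lie on k, Z and W lie on l, and δ(k,l,A,B) holds. Then det(x,y,a)·det(z,w,b) = det(x,y,b)·det(z,w,a), where det(u,v,t) denotes the determinant of the 3×3 matrix whose rows are u, v, t. -/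
theorem dot_comm {R : Type*} [CommRing R] (l a : Fin 3 → R) : dot l a = dot a l := by
  simp only [dot]
  ring

/-- The cross product of two vectors orthogonal to a representative `k` is a multiple of `k`. -/
theorem IsRep.exists_cross_eq_smul_s13 {R : Type*} [CommRing R] {k x y : Fin 3 → R}
    (hk : IsRep k) (hx : dot k x = 0) (hy : dot k y = 0) :
    ∃ s : R, x 1 * y 2 - x 2 * y 1 = s * k 0 ∧ x 2 * y 0 - x 0 * y 2 = s * k 1 ∧
      x 0 * y 1 - x 1 * y 0 = s * k 2 := by
  simp only [dot] at hx hy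
  have h01 : k 0 * (x 2 * y 0 - x 0 * y 2) = k 1 * (x 1 * y 2 - x 2 * y 1) := by
    linear_combination x 2 * hy - y 2 * hx
  have h02 : k 0 * (x 0 * y 1 - x 1 * y 0) = k 2 * (x 1 * y 2 - x 2 * y 1) := by
    linear_combination y 1 * hx - x 1 * hy
  have h12 : k 1 * (x 0 * y 1 - x 1 * y 0) = k 2 * (x 2 * y 0 - x 0 * y 2) := by
    linear_combination x 0 * hy - y 0 * hx
  rcases hk with h | h | h <;> obtain ⟨u, hu⟩ := h.exists_right_inv
  · refine ⟨u * (x 1 * y 2 - x 2 * y 1), ?_, ?_, ?_⟩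
    · linear_combination -(x 1 * y 2 - x 2 * y 1) * hu
    · linear_combination u * h01 - (x 2 * y 0 - x 0 * y 2) * hu
    · linear_combination u * h02 - (x 0 * y 1 - x 1 * y 0) * hu
  · refine ⟨u * (x 2 * y 0 - x 0 * y 2), ?_, ?_, ?_⟩
    · linear_combination -u * h01 - (x 1 * y 2 - x 2 * y 1) * hu
    · linear_combination -(x 2 * y 0 - x 0 * y 2) * hu
    · linear_combination u * h12 - (x 0 * y 1 - x 1 * y 0) * hu
  · refine ⟨u * (x 0 * y 1 - x 1 * y 0), ?_, ?_, ?_⟩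
    · linear_combination -u * h02 - (x 1 * y 2 - x 2 * y 1) * hu
    · linear_combination -u * h12 - (x 2 * y 0 - x 0 * y 2) * hu
    · linear_combination -(x 0 * y 1 - x 1 * y 0) * hu

/-- For `x`, `y` on a line `k`, the determinant `det(x,y,a)` is proportional to `dot k a`. -/
theorem IsRep.exists_det_eq_mul_dot {R : Type*} [CommRing R] {k x y : Fin 3 → R}
    (hk : IsRep k) (hx : dot k x = 0) (hy : dot k y = 0) :
    ∃ s : R, ∀ a : Fin 3 → R, (Matrix.of ![x, y, a]).det = s * dot k a := by
  obtain ⟨s, h0, h1, h2⟩ := hk.exists_cross_eq_smul_s13 hx hy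
  refine ⟨s, fun a => ?_⟩
  simp only [Matrix.det_fin_three, Matrix.of_apply, Matrix.cons_val, dot]
  linear_combination a 0 * h0 + a 1 * h1 + a 2 * h2

theorem Delta.dot_mul_dot_eq {R : Type*} [CommRing R] {k l a b : Fin 3 → R}
    (h : Delta k l a b) : dot k a * dot l b = dot k b * dot l a := by
  obtain ⟨r, X, hr, hX, hra, hrb, hrX, hkX, hlX⟩ := h
  obtain ⟨p, p0, p1, p2⟩ := hX.exists_cross_eq_smul_s13
    ((dot_comm X k).trans hkX) ((dot_comm X l).trans hlX)
  obtain ⟨q, q0, q1, q2⟩ := hr.exists_cross_eq_smul_s13 hra hrb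
  calc dot k a * dot l b
      = dot k b * dot l a + ((k 1 * l 2 - k 2 * l 1) * (a 1 * b 2 - a 2 * b 1) +
          (k 2 * l 0 - k 0 * l 2) * (a 2 * b 0 - a 0 * b 2) +
          (k 0 * l 1 - k 1 * l 0) * (a 0 * b 1 - a 1 * b 0)) := by
        simp only [dot]
        ring
    _ = dot k b * dot l a + p * q * dot r X := by
        rw [p0, p1, p2, q0, q1, q2]
        simp only [dot]
        ring
    _ = dot k b * dot l a := by rw [hrX, mul_zero, add_zero]

/-- If `X`, `Y` lie on `k`, `Z`, `W` lie on `l` and `δ(k,l,A,B)` holds, then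
`det(x,y,a)·det(z,w,b) = det(x,y,b)·det(z,w,a)` (determinants of matrices with the
indicated rows). -/
theorem delta_det_products {R : Type*} [CommRing R]
    (a b x y z w k l : Fin 3 → R)
    (ha : IsRep a) (hb : IsRep b) (hx : IsRep x) (hy : IsRep y)
    (hz : IsRep z) (hw : IsRep w) (hk : IsRep k) (hl : IsRep l)
    (hxk : dot k x = 0) (hyk : dot k y = 0) (hzl : dot l z = 0) (hwl : dot l w = 0)
    (hdelta : Delta k l a b) :
    (Matrix.of ![x, y, a]).det * (Matrix.of ![z, w, b]).det =
      (Matrix.of ![x, y, b]).det * (Matrix.of ![z, w, a]).det := by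
  obtain ⟨s, hs⟩ := hk.exists_det_eq_mul_dot hxk hyk
  obtain ⟨t, ht⟩ := hl.exists_det_eq_mul_dot hzl hwl
  rw [hs, hs, ht, ht]
  linear_combination s * t * hdelta.dot_mul_dot_eq
end
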